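/- Suppose U is an ultrafilter on the complete Boolean algebra B, T is a complete countable theory, and λ is an infinite cardinal. Then the following are equivalent: (A) U λ⁺-saturates T; (B) every (λ, T)-Łoś map in U has a multiplicative refinement in U; (C) every (λ, T)-Łoś map of arity 1 in U has a multiplicative refinement in U. -/

import Mathlib

open FirstOrder FirstOrder.Language Cardinal

namespace BVal

/-! ### Filters and ultrafilters on complete Boolean algebras -/

variable {B : Type} [CompleteBooleanAlgebra B]

/-- A filter on a complete Boolean algebra. -/
def IsBFilter (D : Set B) : Prop :=
  ⊤ ∈ D ∧ ⊥ ∉ D ∧ (∀ a b : B, a ∈ D → a ≤ b → b ∈ D) ∧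
    (∀ a b : B, a ∈ D → b ∈ D → a ⊓ b ∈ D)

/-- An ultrafilter on a complete Boolean algebra. -/
def IsBUltrafilter (U : Set B) : Prop :=
  IsBFilter U ∧ ∀ a : B, a ∈ U ∨ aᶜ ∈ U

/-- An antichain in a complete Boolean algebra: pairwise disjoint nonzero elements. -/
def IsBAntichain (S : Set B) : Prop :=
  (∀ a ∈ S, a ≠ ⊥) ∧ S.Pairwise fun a b => a ⊓ b = ⊥

/-- `ccOf B` is the least cardinal `κ` such that every antichain of `B` has cardinality `< κ`. -/
noncomputable def ccOf (B : Type) [CompleteBooleanAlgebra B] : Cardinal :=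
  sInf {κ : Cardinal | ∀ S : Set B, IsBAntichain S → Cardinal.mk S < κ}

/-! ### Regularity -/

/-- An `I`-quasiregular family: finite meets are nonzero, countably infinite meets are zero. -/
def IsQuasiregularFamily {I : Type} (a : I → B) : Prop :=
  (∀ s : Finset I, s.inf a ≠ ⊥) ∧
    ∀ J : Set I, J.Countable → J.Infinite → (⨅ i ∈ J, a i) = ⊥

/-- An `I`-regular family: quasiregular, and the set of nonzero elements deciding
every member of the family is dense. -/
def IsRegularFamily {I : Type} (a : I → B) : Prop :=
  IsQuasiregularFamily a ∧
    ∀ b : B, b ≠ ⊥ → ∃ b' : B, b' ≠ ⊥ ∧ b' ≤ b ∧ ∀ i, b' ≤ a i ∨ b' ≤ (a i)ᶜ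

/-- A filter `D` is `lam`-regular if it contains some `lam`-regular family. -/
def IsRegularFilter (D : Set B) (lam : Cardinal) : Prop :=
  ∃ a : Quotient.out lam → B, IsRegularFamily a ∧ ∀ α, a α ∈ D

/-! ### Boolean-valued structures -/

/-- Plug the tuple `b` into the `Fin`-indexed free variables of the bounded formula `φ`,
relabelling the parameters along `e`. -/
def plugEmb {L : FirstOrder.Language.{0, 0}} {C D : Type} {k : ℕ} (φ : L.BoundedFormula C k)
    (e : C → D) (b : Fin k → D) : L.Formula D :=
  φ.toFormula.relabel (Sum.elim e b)

/-- Plug the tuple `b` into the `Fin`-indexed free variables of the bounded formula `φ`. -/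
def plug {L : FirstOrder.Language.{0, 0}} {C : Type} {k : ℕ} (φ : L.BoundedFormula C k)
    (b : Fin k → C) : L.Formula C :=
  plugEmb φ id b

/-- The finite conjunction of a list of bounded formulas. -/
def listConj {L : FirstOrder.Language.{0, 0}} {α : Type} {n : ℕ} :
    List (L.BoundedFormula α n) → L.BoundedFormula α n
  | [] => ⊤
  | φ :: l => φ ⊓ listConj l

/-- The axioms for a `B`-valued `L`-structure with carrier `C` and evaluation map `val`,
where formulas with parameters from `C` are encoded as `L.Formula C` (the parameters being
the free variables): logically valid formulas get value `⊤`, negation and conjunction are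
respected, the value of an existential formula is the supremum of the values of its instances,
and distinct elements are not identified. -/
def IsBVal {L : FirstOrder.Language.{0, 0}} {C : Type} (val : L.Formula C → B) : Prop :=
  (∀ φ : L.Formula C,
      (∀ (N : Type) [L.Structure N] [Nonempty N] (v : C → N), φ.Realize v) → val φ = ⊤) ∧
  (∀ φ : L.Formula C, val φ.not = (val φ)ᶜ) ∧
  (∀ φ ψ : L.Formula C, val (φ ⊓ ψ) = val φ ⊓ val ψ) ∧
  (∀ φ : L.BoundedFormula C 1, val φ.ex = ⨆ a : C, val (plug φ fun _ => a)) ∧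
  (∀ a b : C, a ≠ b → val (Term.equal (Term.var a) (Term.var b)) < ⊤)

/-- Fullness of a `B`-valued structure: every existential value is attained. -/
def IsFull {L : FirstOrder.Language.{0, 0}} {C : Type} (val : L.Formula C → B) : Prop :=
  ∀ φ : L.BoundedFormula C 1, ∃ a : C, val φ.ex = val (plug φ fun _ => a)

/-- The `B`-valued structure gives every sentence of `T` the value `⊤`. -/
def BModels {L : FirstOrder.Language.{0, 0}} {C : Type} (val : L.Formula C → B) (T : L.Theory) : Prop :=
  ∀ φ ∈ T, val (Formula.relabel (fun e : Empty => e.elim) φ) = ⊤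

/-- `val` is a full `B`-valued model of `T`. -/
def IsFullBModel {L : FirstOrder.Language.{0, 0}} (T : L.Theory) {C : Type}
    (val : L.Formula C → B) : Prop :=
  IsBVal val ∧ IsFull val ∧ BModels val T

/-- An elementary map between `B`-valued structures. -/
def ElemMap {L : FirstOrder.Language.{0, 0}} {C D : Type} (v : L.Formula C → B) (w : L.Formula D → B)
    (f : C → D) : Prop :=
  ∀ φ : L.Formula C, v φ = w (φ.relabel f)

/-- `lam⁺`-saturation for full `B`-valued models of `T`: elementary maps from models of
cardinality at most `lam` extend along elementary extensions. -/
def BSaturated {L : FirstOrder.Language.{0, 0}} (T : L.Theory) (lam : Cardinal) {C : Type}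
    (val : L.Formula C → B) : Prop :=
  ∀ (C0 C1 : Type) (v0 : L.Formula C0 → B) (v1 : L.Formula C1 → B),
    IsFullBModel T v0 → IsFullBModel T v1 → Cardinal.mk C1 ≤ lam →
    ∀ ι : C0 → C1, ElemMap v0 v1 ι →
    ∀ f : C0 → C, ElemMap v0 val f →
    ∃ g : C1 → C, ElemMap v1 val g ∧ g ∘ ι = f

/-- `lam⁺`-universality for full `B`-valued models of `T`. -/
def BUniversal {L : FirstOrder.Language.{0, 0}} (T : L.Theory) (lam : Cardinal) {C : Type}
    (val : L.Formula C → B) : Prop :=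
  ∀ (C1 : Type) (v1 : L.Formula C1 → B), IsFullBModel T v1 → Cardinal.mk C1 ≤ lam →
    ∃ f : C1 → C, ElemMap v1 val f

/-! ### Ordinary structures, specializations, ordinary saturation -/

/-- A bundled (nonempty) ordinary `L`-structure. -/
structure OrdStructure (L : FirstOrder.Language.{0, 0}) : Type 1 where
  carrier : Type
  [str : L.Structure carrier]
  [nonempty' : Nonempty carrier]

attribute [instance] OrdStructure.str OrdStructure.nonempty'

instance {L : FirstOrder.Language.{0, 0}} : CoeSort (OrdStructure L) Type :=
  ⟨OrdStructure.carrier⟩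

/-- `(N, π)` is a specialization of the `B`-valued structure `val` at the ultrafilter `U`:
`π` is surjective and a formula holds in `N` of the images iff its value lies in `U`. -/
def IsSpecialization {L : FirstOrder.Language.{0, 0}} {C : Type} (val : L.Formula C → B) (U : Set B)
    (N : Type) [L.Structure N] (π : C → N) : Prop :=
  Function.Surjective π ∧ ∀ φ : L.Formula C, (val φ ∈ U ↔ φ.Realize π)

/-- An ordinary structure `N` is `lam⁺`-saturated: every finitely satisfiable set of formulas
in one free variable with parameters from a subset of `N` of cardinality at most `lam`
is realized in `N`. -/
def OrdSaturated (L : FirstOrder.Language.{0, 0}) (lam : Cardinal) (N : Type) [L.Structure N] : Prop :=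
  ∀ A : Set N, Cardinal.mk A ≤ lam →
    ∀ p : Set (L.BoundedFormula A 1),
      (∀ s : Finset (L.BoundedFormula A 1), ↑s ⊆ p →
        ∃ b : N, ∀ φ ∈ s, BoundedFormula.Realize φ Subtype.val fun _ => b) →
      ∃ b : N, ∀ φ ∈ p, BoundedFormula.Realize φ Subtype.val fun _ => b

/-- The ultrafilter `U` on `B` `lam⁺`-saturates the theory `T`: for every `lam⁺`-saturated
full `B`-valued model of `T`, every specialization at `U` is `lam⁺`-saturated. -/
def Saturates {L : FirstOrder.Language.{0, 0}} (U : Set B) (T : L.Theory) (lam : Cardinal) : Prop :=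
  ∀ (C : Type) (val : L.Formula C → B), IsFullBModel T val → BSaturated T lam val →
    ∀ (N : Type) [L.Structure N] (π : C → N), IsSpecialization val U N π →
      OrdSaturated L lam N

/-! ### Distributions -/

/-- An `I`-distribution in `B`. -/
def IsDistribution {I : Type} (A : Finset I → B) : Prop :=
  A ∅ = ⊤ ∧ (∀ s, A s ≠ ⊥) ∧ ∀ s t : Finset I, s ⊆ t → A t ≤ A s

/-- A multiplicative distribution. -/
def MultiplicativeDist {I : Type} (A : Finset I → B) : Prop :=
  ∀ s : Finset I, A s = s.inf fun i => A {i}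

/-- `A'` refines `A`. -/
def Refines {I : Type} (A' A : Finset I → B) : Prop :=
  ∀ s, A' s ≤ A s

/-- `A'` conservatively refines `A`. -/
def ConsRefines {I : Type} (A' A : Finset I → B) : Prop :=
  ∀ s : Finset I, A' s = A s ⊓ s.inf fun i => A' {i}

/-- The distribution `A` lies in the filter `D`. -/
def InFilter {I : Type} (A : Finset I → B) (D : Set B) : Prop :=
  ∀ s, A s ∈ D

/-- `A` has a multiplicative refinement in `D`. -/
def HasMultRefinement {I : Type} (A : Finset I → B) (D : Set B) : Prop :=
  ∃ A' : Finset I → B, IsDistribution A' ∧ MultiplicativeDist A' ∧ InFilter A' D ∧ Refines A' A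

/-- A filter `D` is `lam⁺`-good if every `lam`-distribution in `D` has a multiplicative
refinement in `D`. -/
def IsGoodFilter (D : Set B) (lam : Cardinal) : Prop :=
  ∀ A : Finset (Quotient.out lam) → B, IsDistribution A → InFilter A D →
    HasMultRefinement A D

/-- A distribution is regular if the family of its values at singletons is regular. -/
def IsRegularDistribution {I : Type} (A : Finset I → B) : Prop :=
  IsRegularFamily fun i => A {i}

/-! ### Łoś maps and possibilities -/

/-- An `I`-sequence of formulas `φ_i(x̄, ȳ_i)`: `x̄` has length `n`, `ȳ_i` has length `m i`. -/
structure FormulaSeq (L : FirstOrder.Language.{0, 0}) (I : Type) : Type 1 where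
  n : ℕ
  m : I → ℕ
  φ : ∀ i, L.Formula (Fin n ⊕ Fin (m i))

/-- The formula `∃ x̄, ⋀_{i ∈ s} φ_i(x̄, ā_i)`, with parameters `a`. -/
noncomputable def losFormula {L : FirstOrder.Language.{0, 0}} {C I : Type} (Φ : FormulaSeq L I)
    (a : ∀ i, Fin (Φ.m i) → C) (s : Finset I) : L.Formula C :=
  BoundedFormula.exs (listConj (s.toList.map fun i =>
    BoundedFormula.relabel
      (fun v : Fin Φ.n ⊕ Fin (Φ.m i) =>
        Sum.elim (fun k => Sum.inr k) (fun j => Sum.inl (a i j)) v)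
      (Φ.φ i)))

/-- `A` is a `(I, T, Φ)`-Łoś map. -/
def IsLosMapFor {L : FirstOrder.Language.{0, 0}} (T : L.Theory) {I : Type} (A : Finset I → B)
    (Φ : FormulaSeq L I) : Prop :=
  ∃ (C : Type) (val : L.Formula C → B), IsFullBModel T val ∧
    ∃ a : ∀ i, Fin (Φ.m i) → C, ∀ s : Finset I, A s = val (losFormula Φ a s)

/-- `A` is a `(I, T)`-Łoś map. -/
def IsLosMap {L : FirstOrder.Language.{0, 0}} (T : L.Theory) {I : Type} (A : Finset I → B) : Prop :=
  ∃ Φ : FormulaSeq L I, IsLosMapFor T A Φ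

/-- `A` is a `(I, T)`-Łoś map witnessed by a formula sequence whose `x̄` has length `k`. -/
def IsLosMapOfArity {L : FirstOrder.Language.{0, 0}} (T : L.Theory) {I : Type} (A : Finset I → B)
    (k : ℕ) : Prop :=
  ∃ Φ : FormulaSeq L I, Φ.n = k ∧ IsLosMapFor T A Φ

/-- `A` is a `(I, T)`-possibility: it conservatively refines some `(I, T)`-Łoś map. -/
def IsPossibility {L : FirstOrder.Language.{0, 0}} (T : L.Theory) {I : Type} (A : Finset I → B) : Prop :=
  ∃ A0 : Finset I → B, IsDistribution A0 ∧ IsLosMap T A0 ∧ ConsRefines A A0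

/-! ### Partial types -/

/-- `p` is a partial type over the `B`-valued structure `val`: each finite conjunction has
nonzero existential value. -/
def IsPartialType {L : FirstOrder.Language.{0, 0}} {C : Type} (val : L.Formula C → B) {k : ℕ}
    (p : Set (L.BoundedFormula C k)) : Prop :=
  ∀ Γ : Finset (L.BoundedFormula C k), ↑Γ ⊆ p →
    val (BoundedFormula.exs (listConj Γ.toList)) ≠ ⊥

/-- `p` is a partial `U`-type over `val`: each finite conjunction has existential value in `U`. -/
def IsUType {L : FirstOrder.Language.{0, 0}} {C : Type} (val : L.Formula C → B) (U : Set B) {k : ℕ}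
    (p : Set (L.BoundedFormula C k)) : Prop :=
  ∀ Γ : Finset (L.BoundedFormula C k), ↑Γ ⊆ p →
    val (BoundedFormula.exs (listConj Γ.toList)) ∈ U

/-- The Łoś map of the partial type `p`, as a `p`-distribution. -/
noncomputable def losOfType {L : FirstOrder.Language.{0, 0}} {C : Type} (val : L.Formula C → B) {k : ℕ}
    (p : Set (L.BoundedFormula C k)) : Finset ↥p → B := fun Γ =>
  val (BoundedFormula.exs (listConj (Γ.toList.map Subtype.val)))

/-! ### Boolean ultrapowers -/

/-- The carrier of the Boolean ultrapower `M^B`: maximal antichains indexed by `M`. -/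
def BUP (B : Type) [CompleteBooleanAlgebra B] (M : Type) : Type :=
  {a : M → B // (∀ m m' : M, m ≠ m' → a m ⊓ a m' = ⊥) ∧ (⨆ m, a m) = ⊤}

/-- The evaluation map of the Boolean ultrapower `M^B`. -/
noncomputable def bupVal (B : Type) [CompleteBooleanAlgebra B] {L : FirstOrder.Language.{0, 0}}
    (M : Type) [L.Structure M] : L.Formula (BUP B M) → B := fun φ =>
  letI : DecidableEq (BUP B M) := Classical.decEq _
  ⨆ (w : BUP B M → M) (_ : φ.Realize w), φ.freeVarFinset.inf fun c => c.1 (w c)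

/-- A bundled complete Boolean algebra. -/
structure CBA : Type 1 where
  carrier : Type
  [str : CompleteBooleanAlgebra carrier]

attribute [instance] CBA.str

instance : CoeSort CBA Type := ⟨CBA.carrier⟩

end BVal

open BVal

open FirstOrder FirstOrder.Language Cardinal
open BVal
namespace BVal
variable {B : Type} [CompleteBooleanAlgebra B]

/-- Sikorski-type lemma. -/
theorem exists_bhom {S I : Type} (K : I → Set S) (f : I → B)
    (hK : ∀ J : Finset I, J.inf f ≠ ⊥ → ∃ s, ∀ j ∈ J, s ∈ K j) :
    ∃ h : Set S → B, h Set.univ = ⊤ ∧ (∀ a, h aᶜ = (h a)ᶜ) ∧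
      (∀ a b, h (a ∩ b) = h a ⊓ h b) ∧ ∀ i, f i ≤ h (K i) := by
  classical
  let P := {G : Set S → B // G Set.univ = ⊤ ∧ G ∅ = ⊥ ∧ (∀ a b, G (a ∩ b) = G a ⊓ G b) ∧
    ∀ i, f i ≤ G (K i)}
  let G0 : Set S → B := fun p =>
    ⨆ (J : Finset I) (_ : ∀ s, (∀ j ∈ J, s ∈ K j) → s ∈ p), J.inf f
  have hG0 : G0 Set.univ = ⊤ ∧ G0 ∅ = ⊥ ∧ (∀ a b, G0 (a ∩ b) = G0 a ⊓ G0 b) ∧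
    ∀ i, f i ≤ G0 (K i) := by
    refine ⟨?_, ?_, ?_, ?_⟩
    · refine top_le_iff.1 ?_
      refine le_trans ?_ (le_iSup₂_of_le (∅ : Finset I) (fun s _ => Set.mem_univ s) le_rfl)
      simp
    · refine le_bot_iff.1 (iSup₂_le fun J hJ => ?_)
      by_contra hne
      obtain ⟨s, hs⟩ := hK J (fun h => hne (h ▸ le_rfl))
      exact hJ s hs
    · intro a b
      apply le_antisymm
      · refine iSup₂_le fun J hJ => le_inf ?_ ?_
        · exact le_iSup₂_of_le J (fun s hs => (hJ s hs).1) le_rfl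
        · exact le_iSup₂_of_le J (fun s hs => (hJ s hs).2) le_rfl
      · simp only [G0]
        rw [iSup_inf_eq]
        refine iSup_le fun J => ?_
        rw [iSup_inf_eq]
        refine iSup_le fun hJ => ?_
        rw [inf_iSup_eq]
        refine iSup_le fun J' => ?_
        rw [inf_iSup_eq]
        refine iSup_le fun hJ' => ?_
        refine le_iSup₂_of_le (J ∪ J') (fun s hs => ⟨hJ s fun j hj => hs j ?_, hJ' s fun j hj => hs j ?_⟩) ?_
        · exact Finset.mem_union_left _ hj
        · exact Finset.mem_union_right _ hj
        · rw [Finset.inf_union]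
    · intro i
      refine le_iSup₂_of_le {i} (fun s hs => hs i (by simp)) (by simp)
  have hz : ∃ m : P, IsMax m := by
    apply zorn_le
    intro c hc
    by_cases hne : c.Nonempty
    · obtain ⟨g0, hg0⟩ := hne
      refine ⟨⟨fun p => ⨆ g : c, g.1.1 p, ?_, ?_, ?_, ?_⟩, ?_⟩
      · refine top_le_iff.1 (le_iSup_of_le ⟨g0, hg0⟩ ?_)
        rw [g0.2.1]
      · refine le_bot_iff.1 (iSup_le fun g => ?_)
        rw [g.1.2.2.1]
      · intro a b
        apply le_antisymm
        · refine iSup_le fun g => ?_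
          rw [g.1.2.2.2.1]
          exact inf_le_inf (le_iSup (fun g : c => g.1.1 a) g) (le_iSup (fun g : c => g.1.1 b) g)
        · rw [iSup_inf_iSup]
          refine iSup_le fun ⟨g, g'⟩ => ?_
          rcases hc.total g.2 g'.2 with h | h
          · refine le_iSup_of_le g' ?_
            rw [g'.1.2.2.2.1]
            exact inf_le_inf (h a) le_rfl
          · refine le_iSup_of_le g ?_
            rw [g.1.2.2.2.1]
            exact inf_le_inf le_rfl (h b)
      · intro i
        exact le_iSup_of_le ⟨g0, hg0⟩ (g0.2.2.2.2 i)
      · intro g hg p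
        exact le_iSup (fun g : c => g.1.1 p) ⟨g, hg⟩
    · refine ⟨⟨G0, hG0⟩, fun g hg => (hne ⟨g, hg⟩).elim⟩
  obtain ⟨⟨G, h1, h0, hm, hf⟩, hmax⟩ := hz
  have mono : ∀ a b : Set S, a ⊆ b → G a ≤ G b := by
    intro a b hab
    have := hm a b
    rw [Set.inter_eq_left.2 hab] at this
    rw [this]; exact inf_le_right
  refine ⟨G, h1, ?_, hm, hf⟩
  intro a
  have hdisj : G a ⊓ G aᶜ = ⊥ := by rw [← hm]; simpa using h0
  let c := (G aᶜ)ᶜ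
  let G' : Set S → B := fun p => G p ⊔ (G (p ∪ aᶜ) ⊓ c)
  have hG' : G' Set.univ = ⊤ ∧ G' ∅ = ⊥ ∧ (∀ a b, G' (a ∩ b) = G' a ⊓ G' b) ∧
    ∀ i, f i ≤ G' (K i) := by
    refine ⟨by simp [G', h1], by simp [G', h0, c], ?_, fun i => (hf i).trans le_sup_left⟩
    intro p q
    simp only [G']
    rw [Set.inter_union_distrib_right, hm, hm]
    have e1 : G p ≤ G (p ∪ aᶜ) := mono _ _ Set.subset_union_left
    have e2 : G q ≤ G (q ∪ aᶜ) := mono _ _ Set.subset_union_left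
    apply le_antisymm
    · apply sup_le
      · exact inf_le_inf le_sup_left le_sup_left
      · refine le_inf (le_sup_of_le_right ?_) (le_sup_of_le_right ?_)
        · exact inf_le_inf inf_le_left le_rfl
        · exact inf_le_inf inf_le_right le_rfl
    · rw [inf_sup_left, inf_sup_right, inf_sup_right]
      refine sup_le (sup_le le_sup_left ?_) (sup_le ?_ ?_)
      · refine le_sup_of_le_right (le_inf (le_inf ?_ ?_) ?_)
        · exact inf_le_left.trans inf_le_left
        · exact inf_le_right.trans e2
        · exact inf_le_left.trans inf_le_right
      · refine le_sup_of_le_right (le_inf (le_inf ?_ ?_) ?_)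
        · exact inf_le_left.trans e1
        · exact inf_le_right.trans inf_le_left
        · exact inf_le_right.trans inf_le_right
      · refine le_sup_of_le_right (le_inf (le_inf ?_ ?_) ?_)
        · exact inf_le_left.trans inf_le_left
        · exact inf_le_right.trans inf_le_left
        · exact inf_le_right.trans inf_le_right
  have hle : (⟨G', hG'⟩ : P) ≤ ⟨G, h1, h0, hm, hf⟩ := hmax (fun p => le_sup_left)
  have hca : c ≤ G a := by
    have := hle a
    refine le_trans ?_ this
    refine le_sup_of_le_right (le_inf ?_ le_rfl)
    simp [h1]
  apply le_antisymm
  · exact le_compl_iff_disjoint_left.2 (disjoint_iff.2 hdisj)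
  · exact compl_le_of_compl_le hca

variable {L : FirstOrder.Language.{0, 0}}

/-- A homomorphism from the Lindenbaum algebra on `C` to `B`. -/
def IsHom {C : Type} (val : L.Formula C → B) : Prop :=
  (∀ φ : L.Formula C,
      (∀ (N : Type) [L.Structure N] [Nonempty N] (v : C → N), φ.Realize v) → val φ = ⊤) ∧
  (∀ φ : L.Formula C, val φ.not = (val φ)ᶜ) ∧
  (∀ φ ψ : L.Formula C, val (φ ⊓ ψ) = val φ ⊓ val ψ)

theorem IsBVal.isHom {C : Type} {val : L.Formula C → B} (h : IsBVal val) : IsHom val :=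
  ⟨h.1, h.2.1, h.2.2.1⟩

theorem realize_not' {C N : Type} [L.Structure N] (φ : L.Formula C) (v : C → N) :
    φ.not.Realize v ↔ ¬ φ.Realize v := Formula.realize_not

theorem realize_inf' {C N : Type} [L.Structure N] (φ ψ : L.Formula C) (v : C → N) :
    (φ ⊓ ψ).Realize v ↔ φ.Realize v ∧ ψ.Realize v := by
  simp [Formula.Realize]

namespace IsHom
variable {C : Type} {val : L.Formula C → B}

theorem mono (h : IsHom val) {φ ψ : L.Formula C}
    (hi : ∀ (N : Type) [L.Structure N] [Nonempty N] (v : C → N), φ.Realize v → ψ.Realize v) :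
    val φ ≤ val ψ := by
  have : val (φ ⊓ ψ.not).not = ⊤ := by
    apply h.1
    intro N _ _ v
    rw [realize_not', realize_inf', realize_not']
    have := hi N v
    tauto
  rw [h.2.1, h.2.2, h.2.1, compl_eq_top, ← disjoint_iff] at this
  simpa using this.le_compl_right

theorem congr (h : IsHom val) {φ ψ : L.Formula C}
    (hi : ∀ (N : Type) [L.Structure N] [Nonempty N] (v : C → N), φ.Realize v ↔ ψ.Realize v) :
    val φ = val ψ :=
  le_antisymm (h.mono fun N _ _ v => (hi N v).1) (h.mono fun N _ _ v => (hi N v).2)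

theorem comp (h : IsHom val) {D : Type} (f : D → C) :
    IsHom fun φ : L.Formula D => val (φ.relabel f) := by
  refine ⟨?_, ?_, ?_⟩
  · intro φ hφ
    apply h.1
    intro N _ _ v
    rw [Formula.realize_relabel]
    exact hφ N _
  · intro φ
    rw [← h.2.1]
    apply h.congr
    intro N _ _ v
    simp only [Formula.realize_relabel, realize_not']
  · intro φ ψ
    rw [← h.2.2]
    apply h.congr
    intro N _ _ v
    simp only [Formula.realize_relabel, realize_inf']

/-- finite meets -/
theorem exists_conj (h : IsHom val) {I : Type} (k : I → L.Formula C) (J : Finset I) :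
    ∃ θ : L.Formula C, val θ = J.inf (fun j => val (k j)) ∧
      ∀ (N : Type) [L.Structure N] (v : C → N),
        θ.Realize v ↔ ∀ j ∈ J, (k j).Realize v := by
  classical
  induction J using Finset.induction_on with
  | empty =>
    refine ⟨⊤, ?_, ?_⟩
    · rw [Finset.inf_empty]
      apply h.1
      intro N _ _ v
      simp [Formula.Realize]
    · intro N _ v
      simp [Formula.Realize]
  | insert a s ha ih =>
    obtain ⟨θ, h1, h2⟩ := ih
    refine ⟨k a ⊓ θ, ?_, ?_⟩
    · rw [h.2.2, h1, Finset.inf_insert]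
    · intro N _ v
      rw [realize_inf', h2]
      simp

/-- nonzero formulas are satisfiable -/
theorem exists_real (h : IsHom val) {φ : L.Formula C} (hφ : val φ ≠ ⊥) :
    ∃ (N : Type) (_ : L.Structure N) (_ : Nonempty N) (v : C → N), φ.Realize v := by
  by_contra hc
  apply hφ
  have : val φ.not = ⊤ := by
    apply h.1
    intro N i1 i2 v
    rw [realize_not']
    intro hv
    exact hc ⟨N, i1, i2, v, hv⟩
  rw [h.2.1] at this
  simpa using this

theorem bot_ne_top (h : IsHom val) {φ : L.Formula C} : val (φ ⊓ φ.not) = ⊥ := by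
  rw [h.2.2, h.2.1]; simp

end IsHom

/-- Compactness. -/
theorem compact {X I : Type} (k : I → L.Formula X) (f : I → B)
    (hk : ∀ J : Finset I, J.inf f ≠ ⊥ →
      ∃ (N : Type) (_ : L.Structure N) (_ : Nonempty N) (v : X → N), ∀ j ∈ J, (k j).Realize v) :
    ∃ val : L.Formula X → B, IsHom val ∧ ∀ i, f i ≤ val (k i) := by
  classical
  let S := {J : Finset I // ∃ (N : Type) (_ : L.Structure N) (_ : Nonempty N) (v : X → N),
    ∀ j ∈ J, (k j).Realize v}
  choose N i1 i2 v hv using fun s : S => s.2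
  obtain ⟨h, h1, hc, hi, hf⟩ := exists_bhom (fun i : I => {s : S | (k i).Realize (v s)}) f
    (fun J hJ => ⟨⟨J, hk J hJ⟩, fun j hj => hv ⟨J, hk J hJ⟩ j hj⟩)
  refine ⟨fun φ => h {s : S | φ.Realize (v s)}, ⟨?_, ?_, ?_⟩, hf⟩
  · intro φ hφ
    rw [← h1]
    refine congrArg h (Set.ext fun s => ?_)
    simp only [Set.mem_ofPred_eq, Set.mem_univ, iff_true]
    exact hφ (N s) (v s)
  · intro φ
    rw [← hc]
    congr 1
  · intro φ ψ
    rw [← hi]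
    refine congrArg h (Set.ext fun s => ?_)
    simp only [Set.mem_ofPred_eq, realize_inf', Set.mem_inter_iff]

end BVal

open FirstOrder FirstOrder.Language Cardinal
open BVal
namespace BVal
variable {B : Type} [CompleteBooleanAlgebra B]
variable {L : FirstOrder.Language.{0, 0}}

theorem realize_congr_free {C N : Type} [DecidableEq C] [L.Structure N] (φ : L.Formula C)
    (v v' : C → N) (h : ∀ x ∈ φ.freeVarFinset, v x = v' x) : φ.Realize v ↔ φ.Realize v' := by
  have h1 := BoundedFormula.realize_restrictFreeVar (φ := φ) (f := id)
    (v := fun x => v x) (xs := (default : Fin 0 → N)) v (fun a => rfl)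
  have h2 := BoundedFormula.realize_restrictFreeVar (φ := φ) (f := id)
    (v := fun x => v x) (xs := (default : Fin 0 → N)) v' (fun a => h a a.2)
  exact h1.symm.trans h2

theorem exists_finvars {D E : Type} (ψ : L.Formula (D ⊕ E)) :
    ∃ (m : ℕ) (a : Fin m → D) (φ : L.Formula (E ⊕ Fin m)),
      ∀ (N : Type) [L.Structure N] (v : D → N) (x : E → N),
        φ.Realize (Sum.elim x (v ∘ a)) ↔ ψ.Realize (Sum.elim v x) := by
  classical
  let F := ψ.freeVarFinset
  let G := F.toLeft
  let e := G.equivFin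
  let f : F → E ⊕ Fin G.card := fun p => match p with
    | ⟨.inl d, h⟩ => .inr (e ⟨d, Finset.mem_toLeft.2 h⟩)
    | ⟨.inr x, _⟩ => .inl x
  refine ⟨G.card, fun i => (e.symm i).1, BoundedFormula.restrictFreeVar ψ f, ?_⟩
  intro N _ v x
  refine BoundedFormula.realize_restrictFreeVar (Sum.elim v x) ?_
  rintro ⟨d | y, h⟩ <;> simp [f]

theorem exists_proj {Λ : Type} (I0 : Set Λ) (ψ : L.Formula Λ) :
    ∃ ψ' : L.Formula I0, ∀ (N : Type) [L.Structure N] [Nonempty N] (v : I0 → N),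
      ψ'.Realize v ↔ ∃ u : Λ → N, (∀ i : I0, u i = v i) ∧ ψ.Realize u := by
  classical
  let F := ψ.freeVarFinset
  let f : F → I0 ⊕ F := fun p => if h : p.1 ∈ I0 then .inl ⟨p.1, h⟩ else .inr p
  refine ⟨Formula.iExs F (BoundedFormula.restrictFreeVar ψ f), ?_⟩
  intro N _ hN v
  rw [Formula.realize_iExs]
  constructor
  · rintro ⟨i, hi⟩
    let u : Λ → N := fun x => if h : x ∈ I0 then v ⟨x, h⟩ else
      if h' : x ∈ F then i ⟨x, h'⟩ else hN.some
    refine ⟨u, fun j => by simp [u], ?_⟩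
    refine (BoundedFormula.realize_restrictFreeVar u ?_).1 hi
    intro a
    by_cases ha : a.1 ∈ I0
    · simp [f, u, ha]
    · simp [f, u, ha]
  · rintro ⟨u, hu, h⟩
    refine ⟨fun x => u x, ?_⟩
    refine (BoundedFormula.realize_restrictFreeVar u ?_).2 h
    intro a
    by_cases ha : a.1 ∈ I0
    · simp [f, ha, ← hu]
    · simp [f, ha]

theorem realize_eq {C N : Type} [L.Structure N] (a b : C) (v : C → N) :
    Formula.Realize (Term.equal (L := L) (Term.var a) (Term.var b)) v ↔ v a = v b := by
  simp [Formula.realize_equal]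

theorem IsHom.subst_le {X E : Type} {val : L.Formula X → B} (h : IsHom val) {f g : E → X}
    (hfg : ∀ e, val (Term.equal (Term.var (f e)) (Term.var (g e))) = ⊤) (φ : L.Formula E) :
    val (φ.relabel f) ≤ val (φ.relabel g) := by
  classical
  obtain ⟨θ, h1, h2⟩ := h.exists_conj
    (fun e : E => Term.equal (L := L) (Term.var (f e)) (Term.var (g e))) φ.freeVarFinset
  have h3 : val θ = ⊤ := by
    rw [h1, Finset.inf_congr rfl (fun e _ => hfg e)]
    exact top_le_iff.1 (Finset.le_inf fun _ _ => le_rfl)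
  have h4 : val (θ ⊓ φ.relabel f) ≤ val (φ.relabel g) := by
    apply h.mono
    intro N _ _ v
    rw [realize_inf', h2, Formula.realize_relabel, Formula.realize_relabel]
    rintro ⟨ha, hb⟩
    refine (realize_congr_free φ _ _ ?_).1 hb
    intro x hx
    exact (realize_eq _ _ _).1 (ha x hx)
  rw [h.2.2, h3, top_inf_eq] at h4
  exact h4

theorem IsHom.symm {X : Type} {val : L.Formula X → B} (h : IsHom val) (a b : X) :
    val (Term.equal (Term.var a) (Term.var b)) = val (Term.equal (Term.var b) (Term.var a)) := by
  apply h.congr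
  intro N _ _ v
  rw [realize_eq, realize_eq, eq_comm]

theorem IsHom.subst {X E : Type} {val : L.Formula X → B} (h : IsHom val) {f g : E → X}
    (hfg : ∀ e, val (Term.equal (Term.var (f e)) (Term.var (g e))) = ⊤) (φ : L.Formula E) :
    val (φ.relabel f) = val (φ.relabel g) :=
  le_antisymm (h.subst_le hfg φ) (h.subst_le (fun e => by rw [h.symm]; exact hfg e) φ)

theorem IsHom.relabel_relabel {X E D : Type} {val : L.Formula X → B} (h : IsHom val)
    (f : D → E) (g : E → X) (φ : L.Formula D) :
    val ((φ.relabel f).relabel g) = val (φ.relabel (g ∘ f)) := by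
  apply h.congr
  intro N _ _ v
  simp only [Formula.realize_relabel, Function.comp_assoc]

theorem IsHom.relabel_id {X : Type} {val : L.Formula X → B} (h : IsHom val)
    (f : X → X) (hf : ∀ x, f x = x) (φ : L.Formula X) :
    val (φ.relabel f) = val φ := by
  apply h.congr
  intro N _ _ v
  have : f = id := funext hf
  simp only [Formula.realize_relabel, this, Function.comp_id]

theorem realize_plug {C N : Type} [L.Structure N] (φ : L.BoundedFormula C 1) (a : C) (v : C → N) :
    (plug φ fun _ => a).Realize v ↔ φ.Realize v (fun _ => v a) := by
  simp only [plug, plugEmb, Formula.realize_relabel, BoundedFormula.realize_toFormula]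
  rfl

theorem realize_ex1 {C N : Type} [L.Structure N] (φ : L.BoundedFormula C 1) (v : C → N) :
    Formula.Realize φ.ex v ↔ ∃ a : N, φ.Realize v (fun _ => a) := by
  simp only [Formula.Realize, BoundedFormula.realize_ex]
  refine exists_congr fun a => ?_
  have : (Fin.snoc default a : Fin 1 → N) = fun _ => a := by
    funext i
    rw [show i = Fin.last 0 from Subsingleton.elim (α := Fin 1) _ _]
    simp [Fin.snoc]
  rw [this]

theorem IsHom.plug_le {C : Type} {val : L.Formula C → B} (h : IsHom val)
    (φ : L.BoundedFormula C 1) (a : C) : val (plug φ fun _ => a) ≤ val φ.ex := by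
  apply h.mono
  intro N _ _ v
  rw [realize_plug, realize_ex1]
  exact fun h => ⟨_, h⟩

/-- A full homomorphism is a `B`-valued structure. -/
theorem IsHom.isBVal {C : Type} {val : L.Formula C → B} (h : IsHom val) (hf : IsFull val)
    (hd : ∀ a b : C, val (Term.equal (Term.var a) (Term.var b)) = ⊤ → a = b) : IsBVal val := by
  refine ⟨h.1, h.2.1, h.2.2, ?_, ?_⟩
  · intro φ
    apply le_antisymm
    · obtain ⟨a, ha⟩ := hf φ
      rw [ha]
      exact le_iSup (fun a => val (plug φ fun _ => a)) a
    · exact iSup_le fun a => h.plug_le φ a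
  · intro a b hab
    exact lt_top_iff_ne_top.2 fun h => hab (hd a b h)

/-- Fullness can be tested on formulas with finitely many parameters. -/
theorem IsHom.isFull {C : Type} {val : L.Formula C → B} (h : IsHom val)
    (hw : ∀ (m : ℕ) (a : Fin m → C) (χ : L.Formula (Fin 1 ⊕ Fin m)),
      ∃ c : C, ∀ (θ : L.Formula C),
        (∀ (N : Type) [L.Structure N] (v : C → N),
          θ.Realize v ↔ ∃ x : N, χ.Realize (Sum.elim (fun _ => x) (v ∘ a))) →
        val θ ≤ val (χ.relabel (Sum.elim (fun _ => c) a))) : IsFull val := by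
  intro φ
  obtain ⟨m, a, χ, hχ⟩ := exists_finvars φ.toFormula
  obtain ⟨c, hc⟩ := hw m a χ
  have key : ∀ (N : Type) [L.Structure N] (v : C → N) (x : Fin 1 → N),
      χ.Realize (Sum.elim x (v ∘ a)) ↔ φ.Realize v x := by
    intro N _ v x
    rw [hχ, BoundedFormula.realize_toFormula]
    rfl
  refine ⟨c, le_antisymm ?_ (h.plug_le φ c)⟩
  refine (hc φ.ex ?_).trans (h.mono ?_)
  · intro N _ v
    rw [realize_ex1]
    simp only [key]
  · intro N _ _ v
    rw [realize_plug, Formula.realize_relabel, ← key]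
    have : v ∘ Sum.elim (fun _ : Fin 1 => c) a = Sum.elim (fun _ => v c) (v ∘ a) := by
      funext i; cases i <;> rfl
    rw [this]
    exact id

end BVal

open FirstOrder FirstOrder.Language Cardinal
open BVal
namespace BVal
variable {B : Type} [CompleteBooleanAlgebra B]
variable {L : FirstOrder.Language.{0, 0}}

theorem IsHom.eq_of_le {E : Type} {v w : L.Formula E → B} (hv : IsHom v) (hw : IsHom w)
    (h : ∀ φ, v φ ≤ w φ) (φ : L.Formula E) : v φ = w φ := by
  apply le_antisymm (h φ)
  have := h φ.not
  rw [hv.2.1, hw.2.1] at this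
  exact compl_le_compl_iff_le.1 this

/-- Trees of names for elements of the saturated model. -/
inductive Tree (M Λ Q : Type) : Type
  | base : M → Tree M Λ Q
  | pt : Q → (Λ → Tree M Λ Q) → Λ → Tree M Λ Q

open Classical in
/-- The canonical solution of the problem `q`, `f`. -/
noncomputable def sol {M Λ P : Type} (q : Set Λ × P) (f : Λ → Tree M Λ (Set Λ × P)) :
    Λ → Tree M Λ (Set Λ × P) := fun i => if i ∈ q.1 then f i else Tree.pt q f i

/-- Stages of the construction. -/
structure Stage {M : Type} (Λ : Type) (val0 : L.Formula M → B) where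
  D : Set (Tree M Λ (Set Λ × (L.Formula Λ → B)))
  val : L.Formula (Tree M Λ (Set Λ × (L.Formula Λ → B))) → B
  hom : IsHom val
  base : ∀ m, Tree.base m ∈ D
  ext : ∀ φ : L.Formula M, val (φ.relabel Tree.base) = val0 φ
  inv : ∀ q f i, Tree.pt q f i ∈ D → (∀ j, sol q f j ∈ D) ∧
    ∀ φ : L.Formula Λ, val (φ.relabel (sol q f)) = q.2 φ

namespace Stage
variable {M Λ : Type} {val0 : L.Formula M → B}

instance : Preorder (Stage Λ val0) where
  le p q := p.D ⊆ q.D ∧ ∀ φ : L.Formula p.D,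
    p.val (φ.relabel Subtype.val) = q.val (φ.relabel Subtype.val)
  le_refl p := ⟨Set.Subset.rfl, fun _ => rfl⟩
  le_trans p q r hpq hqr := by
    refine ⟨hpq.1.trans hqr.1, fun φ => ?_⟩
    rw [hpq.2]
    have := hqr.2 (φ.relabel (Set.inclusion hpq.1))
    rw [q.hom.relabel_relabel, r.hom.relabel_relabel] at this
    exact this

theorem le_val {p q : Stage Λ val0} (h : p ≤ q) {E : Type} {g : E → _} (hg : ∀ e, g e ∈ p.D)
    (φ : L.Formula E) : p.val (φ.relabel g) = q.val (φ.relabel g) := by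
  have := h.2 (φ.relabel (fun e => (⟨g e, hg e⟩ : p.D)))
  rw [p.hom.relabel_relabel, q.hom.relabel_relabel] at this
  exact this

/-- The initial stage. -/
theorem nonempty (h0 : IsHom val0) : Nonempty (Stage Λ val0) := by
  obtain ⟨val, hv, hle⟩ := compact (B := B)
    (fun φ : L.Formula M => (φ.relabel Tree.base :
      L.Formula (Tree M Λ (Set Λ × (L.Formula Λ → B))))) val0 (by
    intro J hJ
    obtain ⟨θ, h1, h2⟩ := h0.exists_conj id J
    obtain ⟨N, i1, i2, v, hv⟩ := h0.exists_real (φ := θ) (by rw [h1]; exact hJ)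
    refine ⟨N, i1, i2, fun x => match x with
      | .base m => v m
      | .pt _ _ _ => i2.some, fun j hj => ?_⟩
    rw [Formula.realize_relabel]
    exact (h2 N v).1 hv j hj)
  refine ⟨⟨Set.range Tree.base, val, hv, fun m => ⟨m, rfl⟩, ?_, ?_⟩⟩
  · intro φ
    exact (h0.eq_of_le (hv.comp _) hle φ).symm
  · rintro q f i ⟨m, hm⟩
    cases hm

theorem bdd (h0 : IsHom val0) (c : Set (Stage Λ val0)) (hc : IsChain (· ≤ ·) c) :
    BddAbove c := by
  classical
  by_cases hne : c.Nonempty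
  swap
  · obtain ⟨p⟩ := nonempty (Λ := Λ) h0
    exact ⟨p, fun g hg => (hne ⟨g, hg⟩).elim⟩
  obtain ⟨p0, hp0⟩ := hne
  obtain ⟨val, hv, hle⟩ := compact (B := B)
    (fun φ : (Σ p : c, L.Formula p.1.D) => φ.2.relabel Subtype.val)
    (fun φ => φ.1.1.val (φ.2.relabel Subtype.val)) (by
    intro J hJ
    have hub : ∃ p : c, ∀ j ∈ J, j.1.1 ≤ p.1 := by
      clear hJ
      induction J using Finset.induction_on with
      | empty => exact ⟨⟨p0, hp0⟩, by simp⟩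
      | insert a s ha ih =>
        obtain ⟨p, hp⟩ := ih
        rcases hc.total a.1.2 p.2 with h | h
        · refine ⟨p, fun j hj => ?_⟩
          rcases Finset.mem_insert.1 hj with rfl | hj
          · exact h
          · exact hp j hj
        · refine ⟨a.1, fun j hj => ?_⟩
          rcases Finset.mem_insert.1 hj with rfl | hj
          · exact le_rfl
          · exact (hp j hj).trans h
    obtain ⟨p, hp⟩ := hub
    obtain ⟨θ, h1, h2⟩ := p.1.hom.exists_conj
      (fun φ : (Σ p : c, L.Formula p.1.D) => φ.2.relabel Subtype.val) J
    have : p.1.val θ ≠ ⊥ := by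
      rw [h1]
      convert hJ using 1
      refine Finset.inf_congr rfl fun j hj => ?_
      exact ((hp j hj).2 j.2).symm
    obtain ⟨N, i1, i2, v, hv⟩ := p.1.hom.exists_real this
    exact ⟨N, i1, i2, v, (h2 N v).1 hv⟩)
  have heq : ∀ p : c, ∀ φ : L.Formula p.1.D,
      p.1.val (φ.relabel Subtype.val) = val (φ.relabel Subtype.val) := fun p φ =>
    (p.1.hom.comp Subtype.val).eq_of_le (hv.comp Subtype.val) (fun φ => hle ⟨p, φ⟩) φ
  have heq' : ∀ p : c, ∀ {E : Type} {g : E → _} (_ : ∀ e, g e ∈ p.1.D)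
    (φ : L.Formula E), p.1.val (φ.relabel g) = val (φ.relabel g) := by
    intro p E g hg φ
    have := heq p (φ.relabel (fun e => (⟨g e, hg e⟩ : p.1.D)))
    rw [p.1.hom.relabel_relabel, hv.relabel_relabel] at this
    exact this
  refine ⟨⟨⋃ p : c, p.1.D, val, hv, ?_, ?_, ?_⟩, ?_⟩
  · intro m
    exact Set.mem_iUnion.2 ⟨⟨p0, hp0⟩, p0.base m⟩
  · intro φ
    rw [← heq' ⟨p0, hp0⟩ p0.base, p0.ext]
  · intro q f i hi
    obtain ⟨p, hp⟩ := Set.mem_iUnion.1 hi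
    obtain ⟨h1, h2⟩ := p.1.inv q f i hp
    refine ⟨fun j => Set.mem_iUnion.2 ⟨p, h1 j⟩, fun φ => ?_⟩
    rw [← heq' p h1, h2]
  · intro p hp
    exact ⟨fun x hx => Set.mem_iUnion.2 ⟨⟨p, hp⟩, hx⟩, heq ⟨p, hp⟩⟩

/-- Maximal stages solve all problems. -/
theorem solved (p : Stage Λ val0) (hp : IsMax p) (I0 : Set Λ) (v1 : L.Formula Λ → B)
    (h1 : IsHom v1) (f : Λ → _) (hf : ∀ i ∈ I0, f i ∈ p.D)
    (hag : ∀ φ : L.Formula I0, v1 (φ.relabel Subtype.val) = p.val (φ.relabel fun i : I0 => f i)) :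
    ∃ g : Λ → _, (∀ i, g i ∈ p.D) ∧ (∀ i ∈ I0, g i = f i) ∧
      ∀ φ : L.Formula Λ, p.val (φ.relabel g) = v1 φ := by
  classical
  let q : Set Λ × (L.Formula Λ → B) := (I0, v1)
  have hsol0 : ∀ i ∈ I0, sol q f i = f i := fun i hi => by
    unfold sol; exact if_pos hi
  have hsol1 : ∀ i, i ∉ I0 → sol q f i = Tree.pt q f i := fun i hi => by
    unfold sol; exact if_neg hi
  by_cases hin : ∃ i, Tree.pt q f i ∈ p.D
  · obtain ⟨i, hi⟩ := hin
    obtain ⟨h2, h3⟩ := p.inv q f i hi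
    exact ⟨sol q f, h2, hsol0, h3⟩
  have hin : ∀ i, Tree.pt q f i ∉ p.D := fun i hi => hin ⟨i, hi⟩
  let k : L.Formula p.D ⊕ L.Formula Λ → L.Formula (Tree M Λ (Set Λ × (L.Formula Λ → B))) :=
    Sum.elim (fun φ => φ.relabel Subtype.val) (fun φ => φ.relabel (sol q f))
  let F : L.Formula p.D ⊕ L.Formula Λ → B :=
    Sum.elim (fun φ => p.val (φ.relabel Subtype.val)) v1
  obtain ⟨val, hv, hle⟩ := compact k F (by
    intro J hJ
    obtain ⟨θ1, a1, b1⟩ := (p.hom.comp (Subtype.val : p.D → _)).exists_conj id J.toLeft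
    obtain ⟨θ2, a2, b2⟩ := h1.exists_conj id J.toRight
    obtain ⟨ψ, hψ⟩ := exists_proj I0 θ2
    have c1 : v1 θ2 ≤ p.val (ψ.relabel fun i : I0 => f i) := by
      rw [← hag]
      apply h1.mono
      intro N _ _ v hv
      rw [Formula.realize_relabel, hψ]
      exact ⟨v, fun i => rfl, hv⟩
    have c2 : J.inf F ≤ p.val (θ1.relabel Subtype.val ⊓ ψ.relabel fun i : I0 => f i) := by
      rw [p.hom.2.2]
      refine le_inf ?_ (le_trans ?_ c1)
      · refine le_of_le_of_eq ?_ a1.symm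
        refine Finset.le_inf fun φ hφ => ?_
        exact Finset.inf_le (f := F) (Finset.mem_toLeft.1 hφ)
      · rw [a2]
        refine Finset.le_inf fun φ hφ => ?_
        exact Finset.inf_le (f := F) (Finset.mem_toRight.1 hφ)
    obtain ⟨N, i1, i2, v, hv⟩ := p.hom.exists_real (ne_bot_of_le_ne_bot hJ c2)
    rw [realize_inf', Formula.realize_relabel, Formula.realize_relabel, hψ, b1] at hv
    obtain ⟨hv1, u, hu1, hu2⟩ := hv
    rw [b2] at hu2
    let v' : Tree M Λ (Set Λ × (L.Formula Λ → B)) → N := fun x =>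
      if x ∈ p.D then v x else match x with
      | .base _ => i2.some
      | .pt _ _ i => u i
    have e1 : v' ∘ (Subtype.val : p.D → _) = v ∘ Subtype.val := by
      funext x
      simp [v']
    have e2 : v' ∘ sol q f = u := by
      funext i
      by_cases hi : i ∈ I0
      · rw [Function.comp, hsol0 i hi]
        have := hu1 ⟨i, hi⟩
        simp only [Function.comp] at this
        rw [this]
        exact if_pos (hf i hi)
      · rw [Function.comp, hsol1 i hi]
        exact if_neg (hin i)
    refine ⟨N, i1, i2, v', ?_⟩
    rintro (j | j) hj
    · simp only [k, Sum.elim_inl, Formula.realize_relabel]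
      rw [e1]
      exact hv1 j (Finset.mem_toLeft.2 hj)
    · simp only [k, Sum.elim_inr, Formula.realize_relabel]
      rw [e2]
      exact hu2 j (Finset.mem_toRight.2 hj))
  have heq1 : ∀ φ : L.Formula p.D, p.val (φ.relabel Subtype.val) = val (φ.relabel Subtype.val) :=
    (p.hom.comp Subtype.val).eq_of_le (hv.comp Subtype.val) (fun φ => hle (.inl φ))
  have heq2 : ∀ φ : L.Formula Λ, v1 φ = val (φ.relabel (sol q f)) :=
    h1.eq_of_le (hv.comp (sol q f)) (fun φ => hle (.inr φ))
  have heq' : ∀ {E : Type} {g : E → _} (_ : ∀ e, g e ∈ p.D)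
    (φ : L.Formula E), p.val (φ.relabel g) = val (φ.relabel g) := by
    intro E g hg φ
    have := heq1 (φ.relabel (fun e => (⟨g e, hg e⟩ : p.D)))
    rw [p.hom.relabel_relabel, hv.relabel_relabel] at this
    exact this
  have hinv : ∀ q' f' i, Tree.pt q' f' i ∈ p.D ∪ Set.range (sol q f) →
      (∀ j, sol q' f' j ∈ p.D ∪ Set.range (sol q f)) ∧
      ∀ φ : L.Formula Λ, val (φ.relabel (sol q' f')) = q'.2 φ := by
    intro q' f' i hi
    have old : Tree.pt q' f' i ∈ p.D → (∀ j, sol q' f' j ∈ p.D ∪ Set.range (sol q f)) ∧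
      ∀ φ : L.Formula Λ, val (φ.relabel (sol q' f')) = q'.2 φ := by
      intro hi
      obtain ⟨x1, x2⟩ := p.inv q' f' i hi
      refine ⟨fun j => Or.inl (x1 j), fun φ => ?_⟩
      rw [← heq' x1, x2]
    rcases hi with hi | ⟨j, hj⟩
    · exact old hi
    · by_cases hji : j ∈ I0
      · rw [hsol0 j hji] at hj
        exact old (hj ▸ hf j hji)
      · rw [hsol1 j hji] at hj
        injection hj with e1 e2 e3
        subst e1 e2
        exact ⟨fun j => Or.inr ⟨j, rfl⟩, fun φ => (heq2 φ).symm⟩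
  let p' : Stage Λ val0 := ⟨p.D ∪ Set.range (sol q f), val, hv, fun m => Or.inl (p.base m),
    fun φ => by rw [← heq' p.base, p.ext], hinv⟩
  have hpp : p ≤ p' := ⟨Set.subset_union_left, heq1⟩
  have hpp' := hp hpp
  have hmem : ∀ i, sol q f i ∈ p.D := fun i => hpp'.1 (Or.inr ⟨i, rfl⟩)
  refine ⟨sol q f, hmem, hsol0, fun φ => ?_⟩
  rw [heq' hmem, heq2]

end Stage
end BVal

open FirstOrder FirstOrder.Language Cardinal
open BVal
namespace BVal
variable {B : Type} [CompleteBooleanAlgebra B]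
variable {L : FirstOrder.Language.{0, 0}}

theorem Stage.solved' {M Λ : Type} {val0 : L.Formula M → B} [Nonempty M]
    (p : Stage Λ val0) (hp : IsMax p)
    {E0 E1 : Type} (hE : Cardinal.mk E1 ≤ Cardinal.mk Λ) [Nonempty E1]
    (v1 : L.Formula E1 → B) (h1 : IsHom v1) (ι : E0 → E1) (hι : Function.Injective ι)
    (f : E0 → _) (hf : ∀ i, f i ∈ p.D)
    (hag : ∀ φ : L.Formula E0, v1 (φ.relabel ι) = p.val (φ.relabel f)) :
    ∃ g : E1 → _, (∀ i, g i ∈ p.D) ∧ (∀ i, g (ι i) = f i) ∧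
      ∀ φ : L.Formula E1, p.val (φ.relabel g) = v1 φ := by
  classical
  obtain ⟨e⟩ := Cardinal.le_def _ _ |>.1 hE
  let s : Λ → E1 := Function.invFun e
  have hs : ∀ x, s (e x) = x := Function.leftInverse_invFun e.injective
  let I0 : Set Λ := Set.range (e ∘ ι)
  have hinj : Function.Injective (e ∘ ι) := e.injective.comp hι
  let j : I0 → E0 := fun i => i.2.choose
  have hj : ∀ i : I0, e (ι (j i)) = i.1 := fun i => i.2.choose_spec
  let f' : Λ → _ := fun i => if h : i ∈ I0 then f (j ⟨i, h⟩) else Tree.base (Classical.arbitrary M)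
  have hf' : ∀ i : I0, f' i = f (j i) := fun i => by simp [f']
  obtain ⟨g, g1, g2, g3⟩ := p.solved hp I0 (fun φ => v1 (φ.relabel s)) (h1.comp s) f'
    (by intro i hi; rw [hf' ⟨i, hi⟩]; exact hf _) (by
      intro φ
      have e1 : (fun i : I0 => f' i) = f ∘ j := funext hf'
      have e2 : s ∘ (Subtype.val : I0 → Λ) = ι ∘ j := by
        funext i
        simp only [Function.comp]
        rw [← hj i, hs]
      rw [e1, h1.relabel_relabel, e2, ← h1.relabel_relabel, hag, p.hom.relabel_relabel])
  refine ⟨g ∘ e, fun i => g1 _, ?_, ?_⟩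
  · intro i
    have hi : e (ι i) ∈ I0 := ⟨i, rfl⟩
    simp only [Function.comp]
    rw [g2 _ hi, hf' ⟨_, hi⟩]
    congr 1
    exact hinj (hj ⟨_, hi⟩)
  · intro φ
    rw [← p.hom.relabel_relabel, g3, h1.relabel_relabel]
    exact h1.relabel_id _ hs φ

/-- Existence of saturated extensions. -/
theorem exists_saturated (T : L.Theory) (lam : Cardinal) (hlam : ℵ₀ ≤ lam) {M : Type} [Nonempty M]
    (val0 : L.Formula M → B) (h0 : IsHom val0) :
    ∃ (C : Type) (w : L.Formula C → B), IsBVal w ∧ IsFull w ∧ BSaturated T lam w ∧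
      ∃ e : M → C, ∀ φ, w (φ.relabel e) = val0 φ := by
  classical
  obtain ⟨p, hp⟩ := zorn_le (α := Stage (Quotient.out lam) val0) (Stage.bdd h0)
  have hΛ : Cardinal.mk (Quotient.out lam) = lam := Cardinal.mk_out lam
  let st : Setoid p.D :=
    { r := fun a b => p.val (Term.equal (Term.var a.1) (Term.var b.1)) = ⊤
      iseqv := by
        refine ⟨fun a => ?_, fun {a b} h => ?_, fun {a b c} h1 h2 => ?_⟩
        · apply p.hom.1
          intro N _ _ v
          rw [realize_eq]
        · rw [p.hom.symm]; exact h
        · refine top_le_iff.1 ?_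
          have : p.val (Term.equal (Term.var a.1) (Term.var b.1) ⊓
            Term.equal (Term.var b.1) (Term.var c.1)) ≤
            p.val (Term.equal (Term.var a.1) (Term.var c.1)) := by
            apply p.hom.mono
            intro N _ _ v
            rw [realize_inf', realize_eq, realize_eq, realize_eq]
            exact fun h => h.1.trans h.2
          rw [p.hom.2.2, h1, h2] at this
          simpa using this }
  let C := Quotient st
  let r : C → Tree M (Quotient.out lam) (Set (Quotient.out lam) × (L.Formula (Quotient.out lam) → B)) :=
    fun c => (Quotient.out c).1
  have hr : ∀ c, r c ∈ p.D := fun c => (Quotient.out c).2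
  let cl : p.D → C := fun x => Quotient.mk st x
  have hcl : ∀ x : p.D, p.val (Term.equal (Term.var (r (cl x))) (Term.var x.1)) = ⊤ :=
    fun x => Quotient.mk_out (s := st) x
  have hclr : ∀ c (h : r c ∈ p.D), cl ⟨r c, h⟩ = c := fun c h => Quotient.out_eq c
  have hrc : ∀ {E : Type} (g : E → p.D) (φ : L.Formula E),
      p.val (φ.relabel (r ∘ cl ∘ g)) = p.val (φ.relabel (fun e => (g e).1)) := by
    intro E g φ
    exact p.hom.subst (fun e => hcl (g e)) φ
  let w : L.Formula C → B := fun φ => p.val (φ.relabel r)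
  have hw : IsHom w := p.hom.comp r
  have hfull : IsFull w := by
    apply hw.isFull
    intro m a χ
    let θ0 : L.Formula (Fin m) := Formula.iExs (Fin 1) (χ.relabel Sum.swap)
    have hθ0 : ∀ (N : Type) [L.Structure N] (v : Fin m → N),
        θ0.Realize v ↔ ∃ x : N, χ.Realize (Sum.elim (fun _ => x) v) := by
      intro N _ v
      rw [Formula.realize_iExs]
      have sw : ∀ i : Fin 1 → N, Sum.elim v i ∘ Sum.swap = Sum.elim i v := by
        intro i; funext x; cases x <;> rfl
      simp only [Formula.realize_relabel, sw]
      constructor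
      · rintro ⟨i, hi⟩
        refine ⟨i 0, ?_⟩
        convert hi using 2
        funext x
        rw [Subsingleton.elim x 0]
      · rintro ⟨x, hx⟩
        exact ⟨fun _ => x, hx⟩
    let vm : L.Formula (Fin m) → B := fun φ => w (φ.relabel a)
    have hvm : IsHom vm := hw.comp a
    obtain ⟨v1, h1, hle⟩ := compact (B := B)
      (Sum.elim (fun φ : L.Formula (Fin m) => (φ.relabel Sum.inr : L.Formula (Fin 1 ⊕ Fin m)))
        (fun _ : Unit => χ)) (Sum.elim vm (fun _ => vm θ0)) (by
      intro J hJ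
      obtain ⟨θ1, a1, b1⟩ := hvm.exists_conj (Sum.elim id (fun _ : Unit => θ0)) J
      have : vm θ1 ≠ ⊥ := by
        rw [a1]
        convert hJ using 2
        funext x
        cases x <;> rfl
      obtain ⟨N, i1, i2, v, hv⟩ := hvm.exists_real this
      rw [b1] at hv
      by_cases hu : Sum.inr () ∈ J
      · have := hv _ hu
        simp only [Sum.elim_inr] at this
        obtain ⟨x, hx⟩ := (hθ0 N v).1 this
        refine ⟨N, i1, i2, Sum.elim (fun _ => x) v, ?_⟩
        rintro (j | j) hj
        · simp only [Sum.elim_inl, Formula.realize_relabel, Sum.elim_comp_inr]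
          exact hv _ hj
        · exact hx
      · refine ⟨N, i1, i2, Sum.elim (fun _ => i2.some) v, ?_⟩
        rintro (j | j) hj
        · simp only [Sum.elim_inl, Formula.realize_relabel, Sum.elim_comp_inr]
          exact hv _ hj
        · exact (hu hj).elim)
    have heq : ∀ φ : L.Formula (Fin m), vm φ = v1 (φ.relabel Sum.inr) :=
      hvm.eq_of_le (h1.comp _) (fun φ => hle (.inl φ))
    have hχ : vm θ0 ≤ v1 χ := hle (.inr ())
    obtain ⟨g, g1, g2, g3⟩ := p.solved' hp (E0 := Fin m) (E1 := Fin 1 ⊕ Fin m)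
      (by rw [hΛ]; exact (Cardinal.mk_le_aleph0).trans hlam) v1 h1 Sum.inr Sum.inr_injective
      (r ∘ a) (fun i => hr _) (by
        intro φ
        rw [← heq, ← p.hom.relabel_relabel])
    refine ⟨cl ⟨g (Sum.inl 0), g1 _⟩, fun θ hθ => ?_⟩
    have x1 : w θ = vm θ0 := by
      apply hw.congr
      intro N _ _ v
      rw [hθ, Formula.realize_relabel, hθ0]
    rw [x1]
    refine hχ.trans (le_of_eq ?_)
    rw [← g3]
    simp only [w]
    rw [p.hom.relabel_relabel]
    symm
    apply p.hom.subst
    rintro (i | i)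
    · rw [Subsingleton.elim i 0]
      exact hcl ⟨g (Sum.inl 0), g1 _⟩
    · rw [g2 i]
      apply p.hom.1
      intro N _ _ v
      rw [realize_eq]
      rfl
  have hw1 : ∀ φ, w φ = p.val (φ.relabel r) := fun _ => rfl
  refine ⟨C, w, ?_, hfull, ?_, fun m => cl ⟨Tree.base m, p.base m⟩, ?_⟩
  · refine hw.isBVal hfull ?_
    intro a b hab
    have : p.val (Term.equal (Term.var (r a)) (Term.var (r b))) = ⊤ := by
      rw [← hab, hw1]
      apply p.hom.congr
      intro N _ _ v
      rw [realize_eq, Formula.realize_relabel, realize_eq]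
      rfl
    rw [← hclr a (hr a), ← hclr b (hr b)]
    exact Quotient.sound this
  · intro C0 C1 v0 v1 m0 m1 hcard ι hι f hf
    have n1 : Nonempty C1 := ⟨(m1.2.1 ⊤).choose⟩
    have hinj : Function.Injective ι := by
      intro a b hab
      by_contra hne
      have := m0.1.2.2.2.2 a b hne
      apply this.ne
      rw [hι]
      apply m1.1.1
      intro N _ _ v
      rw [Formula.realize_relabel, realize_eq]
      simp [hab]
    obtain ⟨g, g1, g2, g3⟩ := p.solved' hp (by rw [hΛ]; exact hcard) v1 m1.1.isHom ι hinj
      (r ∘ f) (fun i => hr _) (by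
        intro φ
        rw [← hι, hf, hw1, p.hom.relabel_relabel])
    refine ⟨fun c => cl ⟨g c, g1 c⟩, ?_, ?_⟩
    · intro φ
      rw [hw1, p.hom.relabel_relabel, ← g3]
      exact (hrc (fun c => ⟨g c, g1 c⟩) φ).symm
    · funext i
      simp only [Function.comp]
      have : (⟨g (ι i), g1 (ι i)⟩ : p.D) = ⟨r (f i), hr _⟩ := Subtype.ext (g2 i)
      rw [this, hclr]
  · intro φ
    rw [hw1, p.hom.relabel_relabel]
    exact (hrc (fun m => ⟨Tree.base m, p.base m⟩) φ).trans (p.ext φ)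

end BVal

open FirstOrder FirstOrder.Language Cardinal
open BVal
namespace BVal
variable {B : Type} [CompleteBooleanAlgebra B]
variable {L : FirstOrder.Language.{0, 0}}

/-- Auxiliary Skolem language. -/
def skLang (L : FirstOrder.Language.{0, 0}) : FirstOrder.Language.{0, 0} :=
  ⟨fun m => L.Formula (Fin 1 ⊕ Fin m), fun _ => Empty⟩

/-- Instantiate the parameters of a formula. -/
def instF {C : Type} {m : ℕ} (χ : L.Formula (Fin 1 ⊕ Fin m)) (a : Fin m → C) :
    L.BoundedFormula C 1 :=
  BoundedFormula.relabel (n := 1) (k := 0) (Sum.elim Sum.inr (Sum.inl ∘ a)) χ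

theorem realize_instF {C N : Type} [L.Structure N] {m : ℕ} (χ : L.Formula (Fin 1 ⊕ Fin m))
    (a : Fin m → C) (v : C → N) (x : Fin 1 → N) :
    (instF χ a).Realize v x ↔ χ.Realize (Sum.elim x (v ∘ a)) := by
  unfold instF
  refine (BoundedFormula.realize_relabel (m := 1) (n := 0)).trans ?_
  rw [Formula.Realize]
  have e1 : (Sum.elim v (x ∘ Fin.castAdd 0) ∘ Sum.elim Sum.inr (Sum.inl ∘ a)) =
    Sum.elim x (v ∘ a) := by
    funext i; cases i <;> rfl
  rw [e1, Subsingleton.elim (x ∘ Fin.natAdd 1 : Fin 0 → N) default]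

theorem exists_hull (hL : L.card ≤ ℵ₀) {C : Type} {val : L.Formula C → B} (hv : IsBVal val)
    (hf : IsFull val) (lam : Cardinal) (hlam : ℵ₀ ≤ lam) (E : Set C) (hE : Cardinal.mk E ≤ lam) :
    ∃ C0 : Set C, E ⊆ C0 ∧ Cardinal.mk C0 ≤ lam ∧
      IsBVal (fun φ : L.Formula C0 => val (φ.relabel Subtype.val)) ∧
      IsFull (fun φ : L.Formula C0 => val (φ.relabel Subtype.val)) := by
  classical
  choose wit hwit using hf
  let : (skLang L).Structure C :=
    { funMap := fun {m} χ a => wit (instF (m := m) χ a)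
      RelMap := fun {_} r _ => r.elim }
  let S := Substructure.closure (skLang L) E
  have hfun : Cardinal.mk (Σ m, (skLang L).Functions m) ≤ ℵ₀ := by
    have : Countable (Σ l, L.Functions l) := by
      rw [← Cardinal.mk_le_aleph0_iff]
      refine le_trans ?_ hL
      rw [Language.card, Cardinal.mk_sum]
      simp
    have : Countable (Σ l, L.Relations l) := by
      rw [← Cardinal.mk_le_aleph0_iff]
      refine le_trans ?_ hL
      rw [Language.card, Cardinal.mk_sum]
      simp
    have hc : ∀ m, Countable (L.Formula (Fin 1 ⊕ Fin m)) := by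
      intro m
      rw [← Cardinal.mk_le_aleph0_iff]
      have h1 : Cardinal.mk (L.Formula (Fin 1 ⊕ Fin m)) ≤
          Cardinal.mk (Σ n, L.BoundedFormula (Fin 1 ⊕ Fin m) n) :=
        Cardinal.mk_le_of_injective (f := fun φ => ⟨0, φ⟩) (fun a b h => by simpa using h)
      refine h1.trans (BoundedFormula.card_le.trans (max_le le_rfl ?_))
      simp only [Cardinal.lift_id]
      exact Cardinal.add_le_aleph0.2 ⟨Cardinal.mk_le_aleph0, hL⟩
    have : ∀ m, Countable ((skLang L).Functions m) := hc
    exact Cardinal.mk_le_aleph0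
  have hcard : Cardinal.mk S ≤ lam := by
    have := Substructure.lift_card_closure_le (L := skLang L) (s := E)
    simp only [Cardinal.lift_id] at this
    refine this.trans (max_le hlam ?_)
    exact Cardinal.add_le_of_le hlam hE (hfun.trans hlam)
  have hh : IsHom (fun φ : L.Formula (S : Set C) => val (φ.relabel Subtype.val)) :=
    hv.isHom.comp _
  have hfull : IsFull (fun φ : L.Formula (S : Set C) => val (φ.relabel Subtype.val)) := by
    apply hh.isFull
    intro m a χ
    let a' : Fin m → C := fun i => (a i).1
    have hmem : wit (instF χ a') ∈ S := S.fun_mem (n := m) χ a' (fun i => (a i).2)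
    refine ⟨⟨_, hmem⟩, fun θ hθ => ?_⟩
    have e1 : val (θ.relabel Subtype.val) = val (instF χ a').ex := by
      apply hv.isHom.congr
      intro N _ _ v
      rw [Formula.realize_relabel, hθ, realize_ex1]
      refine exists_congr fun x => ?_
      rw [realize_instF]
      rfl
    refine le_of_eq ?_
    refine e1.trans ((hwit _).trans ?_)
    apply hv.isHom.congr
    intro N _ _ v
    rw [realize_plug, realize_instF, Formula.realize_relabel, Formula.realize_relabel]
    refine iff_of_eq (congrArg _ ?_)
    funext i; cases i <;> rfl
  refine ⟨S, Substructure.subset_closure, hcard, ?_, hfull⟩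
  refine hh.isBVal hfull ?_
  intro a b hab
  by_contra hne
  have := hv.2.2.2.2 a.1 b.1 (fun h => hne (Subtype.ext h))
  apply this.ne
  rw [← hab]
  apply hv.isHom.congr
  intro N _ _ v
  rw [realize_eq, Formula.realize_relabel, realize_eq]
  rfl

theorem exists_spec {U : Set B} (hU : IsBUltrafilter U) {C : Type} {val : L.Formula C → B}
    (hv : IsHom val) (hf : IsFull val) :
    ∃ (N : Type) (_ : L.Structure N) (π : C → N), IsSpecialization val U N π := by
  classical
  obtain ⟨⟨hU1, hU0, hUup, hUinf⟩, hUu⟩ := hU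
  let T' : (L[[C]]).Theory := Set.image Formula.equivSentence {φ : L.Formula C | val φ ∈ U}
  have hsat : T'.IsSatisfiable := by
    rw [Theory.isSatisfiable_iff_isFinitelySatisfiable]
    intro T0 hT0
    let J : Finset (L.Formula C) := T0.image Formula.equivSentence.symm
    obtain ⟨θ, h1, h2⟩ := hv.exists_conj id J
    have hJ : ∀ φ ∈ J, val φ ∈ U := by
      intro φ hφ
      obtain ⟨σ, hσ, rfl⟩ := Finset.mem_image.1 hφ
      obtain ⟨φ', hφ', h⟩ := hT0 hσ
      rw [← h, Equiv.symm_apply_apply]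
      exact hφ'
    have hθ : val θ ∈ U := by
      rw [h1]
      refine Finset.inf_induction hU1 (fun a ha b hb => hUinf a b ha hb) hJ
    obtain ⟨N, i1, i2, v, hN⟩ := hv.exists_real (φ := θ) (fun h => hU0 (h ▸ hθ))
    rw [h2] at hN
    let : (constantsOn C).Structure N := constantsOn.structure v
    have : N ⊨ (T0 : (L[[C]]).Theory) := by
      refine ⟨fun σ hσ => ?_⟩
      rw [← Formula.realize_equivSentence_symm_con]
      exact hN _ (Finset.mem_image.2 ⟨σ, hσ, rfl⟩)
    exact Theory.Model.isSatisfiable N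
  obtain ⟨N'⟩ := hsat
  let : L.Structure N' := (L.lhomWithConstants C).reduct N'
  have : (L.lhomWithConstants C).IsExpansionOn N' := LHom.isExpansionOn_reduct _ _
  let v : C → N' := fun a => (L.con a : N')
  have hvU : ∀ φ : L.Formula C, val φ ∈ U → φ.Realize v := by
    intro φ hφ
    rw [← Formula.realize_equivSentence]
    exact N'.is_model.realize_of_mem _ ⟨φ, hφ, rfl⟩
  have hvU' : ∀ φ : L.Formula C, val φ ∈ U ↔ φ.Realize v := by
    intro φ
    refine ⟨hvU φ, fun h => ?_⟩
    rcases hUu (val φ) with h' | h'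
    · exact h'
    · rw [← hv.2.1] at h'
      exact ((realize_not' _ _).1 (hvU _ h') h).elim
  have hW : ∀ φ : L.BoundedFormula C 1, (∃ a : N', φ.Realize v (fun _ => a)) →
      ∃ c, φ.Realize v (fun _ => v c) := by
    intro φ h
    rw [← realize_ex1, ← hvU'] at h
    obtain ⟨c, hc⟩ := hf φ
    rw [hc, hvU', realize_plug] at h
    exact ⟨c, h⟩
  let S : L.Substructure N' :=
    { carrier := Set.range v
      fun_mem := by
        intro n f xs hxs
        choose c hc using hxs
        obtain ⟨d, hd⟩ := hW (Term.bdEqual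
          (Term.func f (fun i => Term.var (Sum.inl (c i)))) (Term.var (Sum.inr 0)))
          ⟨Structure.funMap f xs, by simp [hc]⟩
        refine ⟨d, ?_⟩
        simp only [BoundedFormula.realize_bdEqual, Term.realize_func, Term.realize_var,
          Sum.elim_inl, Sum.elim_inr, hc] at hd
        exact hd.symm }
  let S' : L.ElementarySubstructure N' := S.toElementarySubstructure (by
    intro n φ x a hφ
    choose c hc using fun i => (x i).2
    let ψ : L.BoundedFormula C 1 := BoundedFormula.relabel (n := 1) (k := 0)
      (Sum.elim Empty.elim (Fin.snoc (α := fun _ => C ⊕ Fin 1) (fun i => Sum.inl (c i)) (Sum.inr 0)))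
      φ.toFormula
    have hψ : ∀ b : N', ψ.Realize v (fun _ => b) ↔
        φ.Realize default (Fin.snoc ((↑) ∘ x) b : _ → N') := by
      intro b
      refine (BoundedFormula.realize_relabel (m := 1) (n := 0)).trans ?_
      have : ∀ z z' : Fin 0 → N', z = z' := fun z z' => Subsingleton.elim _ _
      rw [this (_ ∘ _) default]
      refine (BoundedFormula.realize_toFormula φ _).trans ?_
      refine iff_of_eq ?_
      congr 1
      · exact Subsingleton.elim _ _
      · funext i
        refine Fin.lastCases ?_ (fun i => ?_) i
        · simp
        · simp [hc]
    obtain ⟨d, hd⟩ := hW ψ ⟨a, (hψ a).2 hφ⟩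
    exact ⟨⟨v d, d, rfl⟩, (hψ _).1 hd⟩)
  refine ⟨S', inferInstance, fun c => ⟨v c, c, rfl⟩, ?_, ?_⟩
  · rintro ⟨_, c, rfl⟩
    exact ⟨c, rfl⟩
  · intro φ
    rw [hvU', ← S'.subtype.map_formula]
    rfl

end BVal

open FirstOrder FirstOrder.Language Cardinal
open BVal
namespace BVal
variable {B : Type} [CompleteBooleanAlgebra B]
variable {L : FirstOrder.Language.{0, 0}}

theorem realize_listConj {α N : Type} [L.Structure N] {n : ℕ} (l : List (L.BoundedFormula α n))
    (v : α → N) (x : Fin n → N) :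
    (listConj l).Realize v x ↔ ∀ φ ∈ l, φ.Realize v x := by
  induction l with
  | nil => simp [listConj]
  | cons φ l ih => simp [listConj, ih]

theorem realize_los {C I N : Type} [L.Structure N] (Φ : FormulaSeq L I)
    (a : ∀ i, Fin (Φ.m i) → C) (s : Finset I) (v : C → N) :
    (losFormula Φ a s).Realize v ↔
      ∃ x : Fin Φ.n → N, ∀ i ∈ s, (Φ.φ i).Realize (Sum.elim x (v ∘ a i)) := by
  unfold losFormula
  rw [BoundedFormula.realize_exs]
  refine exists_congr fun x => ?_
  rw [realize_listConj]
  simp only [List.mem_map, Finset.mem_toList, forall_exists_index, and_imp,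
    forall_apply_eq_imp_iff₂]
  refine forall₂_congr fun i _ => ?_
  refine (BoundedFormula.realize_relabel (m := Φ.n) (n := 0)).trans ?_
  rw [Formula.Realize]
  refine iff_of_eq ?_
  congr 1
  · funext y; cases y <;> rfl
  · exact Subsingleton.elim _ _

theorem card_bf (hL : L.card ≤ ℵ₀) {lam : Cardinal} (hlam : ℵ₀ ≤ lam) {α : Type}
    (hα : Cardinal.mk α ≤ lam) (n : ℕ) : Cardinal.mk (L.BoundedFormula α n) ≤ lam := by
  have h1 : Cardinal.mk (L.BoundedFormula α n) ≤ Cardinal.mk (Σ n, L.BoundedFormula α n) :=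
    Cardinal.mk_le_of_injective (f := fun φ => ⟨n, φ⟩) (fun a b h => by simpa using h)
  refine h1.trans (BoundedFormula.card_le.trans (max_le hlam ?_))
  simp only [Cardinal.lift_id]
  exact Cardinal.add_le_of_le hlam hα (hL.trans hlam)

theorem OrdSaturated.tuple {N : Type} [L.Structure N] {lam : Cardinal} (hlam : ℵ₀ ≤ lam)
    (h : OrdSaturated L lam N) (n : ℕ) : ∀ (A : Set N), Cardinal.mk A ≤ lam →
    ∀ p : Set (L.BoundedFormula A n),
      (∀ s : Finset (L.BoundedFormula A n), ↑s ⊆ p →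
        ∃ b : Fin n → N, ∀ φ ∈ s, BoundedFormula.Realize φ Subtype.val b) →
      ∃ b : Fin n → N, ∀ φ ∈ p, BoundedFormula.Realize φ Subtype.val b := by
  classical
  induction n with
  | zero =>
    intro A hA p hp
    refine ⟨default, fun φ hφ => ?_⟩
    obtain ⟨b, hb⟩ := hp {φ} (by simpa using hφ)
    rw [Subsingleton.elim default b]
    exact hb φ (by simp)
  | succ n ih =>
    intro A hA p hp
    let q : Set (L.BoundedFormula A n) :=
      {θ | ∃ s : Finset (L.BoundedFormula A (n + 1)), ↑s ⊆ p ∧ θ = (listConj s.toList).ex}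
    obtain ⟨b, hb⟩ := ih A hA q (by
      intro t ht
      choose! S hS1 hS2 using fun θ (hθ : θ ∈ t) => ht hθ
      obtain ⟨b, hb⟩ := hp (t.biUnion S) (by
        intro φ hφ
        obtain ⟨θ, hθ, hφ⟩ := Finset.mem_biUnion.1 (Finset.mem_coe.1 hφ)
        exact hS1 θ hθ hφ)
      refine ⟨fun i => b i.castSucc, fun θ hθ => ?_⟩
      rw [hS2 θ hθ, BoundedFormula.realize_ex]
      refine ⟨b (Fin.last n), ?_⟩
      rw [realize_listConj]
      intro φ hφ
      have e : (Fin.snoc (fun i => b i.castSucc) (b (Fin.last n)) : Fin (n + 1) → N) = b := by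
        funext i
        refine Fin.lastCases ?_ (fun i => ?_) i <;> simp
      rw [e]
      exact hb φ (Finset.mem_biUnion.2 ⟨θ, hθ, Finset.mem_toList.1 hφ⟩))
    let A' : Set N := A ∪ Set.range b
    have hA' : Cardinal.mk A' ≤ lam := by
      refine (Cardinal.mk_union_le _ _).trans (Cardinal.add_le_of_le hlam hA ?_)
      exact Cardinal.mk_le_aleph0.trans hlam
    let tr : L.BoundedFormula A (n + 1) → L.BoundedFormula A' 1 := fun φ =>
      BoundedFormula.relabel (n := 1) (k := 0)
        (Sum.elim (fun a : A => Sum.inl (⟨a.1, Or.inl a.2⟩ : A'))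
          (Fin.snoc (α := fun _ => A' ⊕ Fin 1)
            (fun i => Sum.inl (⟨b i, Or.inr ⟨i, rfl⟩⟩ : A')) (Sum.inr 0))) φ.toFormula
    have htr : ∀ φ (x : N), (tr φ).Realize Subtype.val (fun _ => x) ↔
        φ.Realize Subtype.val (Fin.snoc b x : Fin (n + 1) → N) := by
      intro φ x
      refine (BoundedFormula.realize_relabel (m := 1) (n := 0)).trans ?_
      have : ∀ z z' : Fin 0 → N, z = z' := fun z z' => Subsingleton.elim _ _
      rw [this (_ ∘ _) default]
      refine (BoundedFormula.realize_toFormula φ _).trans ?_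
      refine iff_of_eq ?_
      congr 1
      funext i
      refine Fin.lastCases ?_ (fun i => ?_) i
      · simp
      · simp
    obtain ⟨x, hx⟩ := h A' hA' (Set.image tr p) (by
      intro t ht
      obtain ⟨s, hs, rfl⟩ := Finset.subset_set_image_iff.1 ht
      have := hb _ ⟨s, hs, rfl⟩
      rw [BoundedFormula.realize_ex] at this
      obtain ⟨x, hx⟩ := this
      rw [realize_listConj] at hx
      refine ⟨x, fun φ hφ => ?_⟩
      obtain ⟨φ', h1, rfl⟩ := Finset.mem_image.1 hφ
      rw [htr]
      exact hx φ' (Finset.mem_toList.2 h1))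
    exact ⟨Fin.snoc b x, fun φ hφ => (htr φ x).1 (hx _ ⟨φ, hφ, rfl⟩)⟩

theorem BModels.of_elem {T : L.Theory} {C D : Type} {v : L.Formula C → B} {w : L.Formula D → B}
    (hw : IsHom w) {f : C → D} (hf : ∀ φ, v φ = w (φ.relabel f)) :
    BModels v T ↔ BModels w T := by
  unfold BModels
  refine forall₂_congr fun φ _ => ?_
  rw [hf, hw.relabel_relabel]
  have : (f ∘ fun e : Empty => e.elim) = fun e : Empty => e.elim := Subsingleton.elim _ _
  rw [this]

theorem sat_imp_los {U : Set B} (hU : IsBUltrafilter U) {T : L.Theory}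
    {lam : Cardinal} (hlam : ℵ₀ ≤ lam) (hS : Saturates U T lam)
    (A : Finset (Quotient.out lam) → B) (hAU : InFilter A U)
    (hA : IsLosMap T A) : HasMultRefinement A U := by
  classical
  obtain ⟨Φ, M, val, ⟨hM1, hM2, hM3⟩, a, ha⟩ := hA
  have : Nonempty M := ⟨(hM2 ⊤).choose⟩
  obtain ⟨C, w, hw1, hw2, hw3, e, he⟩ := exists_saturated T lam hlam val hM1.isHom
  have hwT : BModels w T := (BModels.of_elem hw1.isHom (fun φ => (he φ).symm)).1 hM3
  obtain ⟨N, i1, π, hπ1, hπ2⟩ := exists_spec hU hw1.isHom hw2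
  have hsat := hS C w ⟨hw1, hw2, hwT⟩ hw3 N π ⟨hπ1, hπ2⟩
  let a' : ∀ i, Fin (Φ.m i) → C := fun i => e ∘ a i
  have hA' : ∀ s, A s = w (losFormula Φ a' s) := by
    intro s
    rw [ha, ← he]
    apply hw1.isHom.congr
    intro N _ _ v
    rw [Formula.realize_relabel, realize_los, realize_los]
    rfl
  let P : Set N := ⋃ i, Set.range (π ∘ a' i)
  have hP : Cardinal.mk P ≤ lam := by
    refine (Cardinal.mk_iUnion_le _).trans ?_
    rw [Cardinal.mk_out]
    have : (⨆ i, Cardinal.mk (Set.range (π ∘ a' i))) ≤ ℵ₀ :=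
      ciSup_le' fun i => Cardinal.mk_le_aleph0
    refine (mul_le_mul' le_rfl (this.trans hlam)).trans ?_
    rw [Cardinal.mul_eq_self hlam]
  have hPm : ∀ i j, π (a' i j) ∈ P := fun i j => Set.mem_iUnion.2 ⟨i, j, rfl⟩
  let tr : Quotient.out lam → L.BoundedFormula P Φ.n := fun i =>
    BoundedFormula.relabel (n := Φ.n) (k := 0)
      (Sum.elim Sum.inr (fun j => Sum.inl ⟨π (a' i j), hPm i j⟩)) (Φ.φ i)
  have htr : ∀ i x, (tr i).Realize Subtype.val x ↔
      (Φ.φ i).Realize (Sum.elim x (π ∘ a' i)) := by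
    intro i x
    refine (BoundedFormula.realize_relabel (m := Φ.n) (n := 0)).trans ?_
    rw [Formula.Realize]
    refine iff_of_eq ?_
    congr 1
    · funext y; cases y <;> rfl
    · exact Subsingleton.elim _ _
  obtain ⟨b, hb⟩ := hsat.tuple hlam Φ.n P hP (Set.range tr) (by
    intro t ht
    rw [← Set.image_univ] at ht
    obtain ⟨s, -, rfl⟩ := Finset.subset_set_image_iff.1 ht
    have := hAU s
    rw [hA', hπ2, realize_los] at this
    obtain ⟨x, hx⟩ := this
    refine ⟨x, fun φ hφ => ?_⟩
    obtain ⟨i, hi, rfl⟩ := Finset.mem_image.1 hφ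
    exact (htr i x).2 (hx i hi))
  choose c hc using fun k => hπ1 (b k)
  let k : Quotient.out lam → L.Formula C := fun i => (Φ.φ i).relabel (Sum.elim c (a' i))
  have hk : ∀ i, w (k i) ∈ U := by
    intro i
    rw [hπ2, Formula.realize_relabel]
    have := (htr i b).1 (hb _ ⟨i, rfl⟩)
    convert this using 1
    funext y
    cases y <;> simp [hc]
  have hin : ∀ s : Finset (Quotient.out lam), s.inf (fun i => w (k i)) ∈ U := fun s =>
    Finset.inf_induction hU.1.1 (fun a ha b hb => hU.1.2.2.2 a b ha hb) (fun i _ => hk i)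
  refine ⟨fun s => s.inf fun i => w (k i), ⟨by simp, fun s h => hU.1.2.1 ?_, ?_⟩, ?_, hin, ?_⟩
  · rw [← h]; exact hin s
  · intro s t hst
    exact Finset.inf_mono hst
  · intro s
    simp
  · intro s
    obtain ⟨θ, h1, h2⟩ := hw1.isHom.exists_conj k s
    rw [hA']
    refine le_of_eq_of_le h1.symm ?_
    apply hw1.isHom.mono
    intro N _ _ v hv
    rw [h2] at hv
    rw [realize_los]
    refine ⟨v ∘ c, fun i hi => ?_⟩
    have := hv i hi
    rw [Formula.realize_relabel] at this
    convert this using 1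
    funext y
    cases y <;> rfl

theorem los_imp_sat {U : Set B} (hU : IsBUltrafilter U) (hL : L.card ≤ ℵ₀) {T : L.Theory}
    {lam : Cardinal} (hlam : ℵ₀ ≤ lam)
    (hS : ∀ A : Finset (Quotient.out lam) → B, IsDistribution A → InFilter A U →
          IsLosMapOfArity T A 1 → HasMultRefinement A U) : Saturates U T lam := by
  classical
  intro C val hM hsat N _ π hπ A hA p hp
  by_cases hpne : p.Nonempty
  swap
  · obtain ⟨b, -⟩ := hp ∅ (by simp)
    exact ⟨b, fun φ hφ => (hpne ⟨φ, hφ⟩).elim⟩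
  have hval : IsHom val := hM.1.isHom
  have hpc : Cardinal.mk p ≤ Cardinal.mk (Quotient.out lam) := by
    rw [Cardinal.mk_out]
    exact (Cardinal.mk_subtype_le p).trans (card_bf hL hlam hA 1)
  obtain ⟨em⟩ := Cardinal.le_def _ _ |>.1 hpc
  have : Nonempty p := hpne.to_subtype
  let enum : Quotient.out lam → p := Function.invFun em
  have henum : ∀ x, enum (em x) = x := Function.leftInverse_invFun em.injective
  choose m a χ hχ using fun i => exists_finvars (enum i).1.toFormula
  have hχ' : ∀ i (K : Type) [L.Structure K] (v : A → K) (x : Fin 1 → K),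
      (χ i).Realize (Sum.elim x (v ∘ a i)) ↔ (enum i).1.Realize v x := by
    intro i K _ v x
    rw [hχ, BoundedFormula.realize_toFormula]
    rfl
  let Φ : FormulaSeq L (Quotient.out lam) := ⟨1, m, χ⟩
  choose ρ hρ using fun x : A => hπ.1 x.1
  have hπρ : ∀ i, π ∘ (ρ ∘ a i) = Subtype.val ∘ a i := fun i => funext fun j => hρ _
  let A0 : Finset (Quotient.out lam) → B := fun s => val (losFormula Φ (fun i => ρ ∘ a i) s)
  have hA0U : InFilter A0 U := by
    intro s
    simp only [A0]
    rw [hπ.2, realize_los]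
    obtain ⟨b, hb⟩ := hp (s.image fun i => (enum i).1) (by
      intro φ hφ
      obtain ⟨i, -, rfl⟩ := Finset.mem_image.1 (Finset.mem_coe.1 hφ)
      exact (enum i).2)
    refine ⟨fun _ => b, fun i hi => ?_⟩
    rw [hπρ]
    exact (hχ' i N Subtype.val (fun _ => b)).2 (hb _ (Finset.mem_image.2 ⟨i, hi, rfl⟩))
  obtain ⟨A', hA'1, hA'2, hA'3, hA'4⟩ := hS A0 (by
      refine ⟨?_, fun s h => hU.1.2.1 (h ▸ hA0U s), ?_⟩
      · apply hval.1
        intro K _ hK v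
        rw [realize_los]
        exact ⟨fun _ => hK.some, by simp⟩
      · intro s t hst
        apply hval.mono
        intro K _ _ v
        rw [realize_los, realize_los]
        exact fun ⟨x, hx⟩ => ⟨x, fun i hi => hx i (hst hi)⟩) hA0U
    ⟨Φ, rfl, C, val, hM, _, fun s => rfl⟩
  obtain ⟨C0, hC0, hC0c, hb0, hf0⟩ := exists_hull hL hM.1 hM.2.1 lam hlam (Set.range ρ)
    (Cardinal.mk_range_le.trans hA)
  let v0 : L.Formula C0 → B := fun φ => val (φ.relabel Subtype.val)
  have h0 : IsHom v0 := hb0.isHom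
  let b : ∀ i, Fin (m i) → C0 := fun i j => ⟨ρ (a i j), hC0 ⟨_, rfl⟩⟩
  let kχ : Quotient.out lam → L.Formula (Option C0) := fun i =>
    (χ i).relabel (Sum.elim (fun _ => none) (some ∘ b i))
  obtain ⟨v2, h2, hle⟩ := compact
    (Sum.elim (fun φ : L.Formula C0 => φ.relabel some) kχ)
    (Sum.elim v0 (fun i => A' {i})) (by
    intro J hJ
    obtain ⟨θ1, a1, b1⟩ := h0.exists_conj id J.toLeft
    have hne : v0 (θ1 ⊓ losFormula Φ b J.toRight) ≠ ⊥ := by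
      refine ne_bot_of_le_ne_bot hJ ?_
      rw [h0.2.2]
      apply le_inf
      · refine le_of_le_of_eq ?_ a1.symm
        refine Finset.le_inf fun φ hφ => ?_
        exact Finset.inf_le (f := Sum.elim v0 (fun i => A' {i})) (Finset.mem_toLeft.1 hφ)
      · have e1 : v0 (losFormula Φ b J.toRight) = A0 J.toRight := by
          apply hval.congr
          intro K _ _ v
          rw [Formula.realize_relabel, realize_los, realize_los]
          rfl
        rw [e1]
        refine le_trans ?_ (hA'4 _)
        rw [hA'2]
        refine Finset.le_inf fun φ hφ => ?_
        exact Finset.inf_le (f := Sum.elim v0 (fun i => A' {i})) (Finset.mem_toRight.1 hφ)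
    obtain ⟨K, i1, i2, v, hv⟩ := h0.exists_real hne
    rw [realize_inf', b1, realize_los] at hv
    obtain ⟨hv1, x, hx⟩ := hv
    refine ⟨K, i1, i2, fun o => o.elim (x 0) v, ?_⟩
    rintro (j | j) hj
    · simp only [Sum.elim_inl, Formula.realize_relabel]
      exact hv1 j (Finset.mem_toLeft.2 hj)
    · simp only [Sum.elim_inr, kχ, Formula.realize_relabel]
      have := hx j (Finset.mem_toRight.2 hj)
      convert this using 1
      funext y
      rcases y with y | y
      · simp only [Function.comp, Sum.elim_inl, Option.elim]
        exact congrArg x (Subsingleton.elim (α := Fin 1) _ _)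
      · rfl)
  have heq : ∀ φ : L.Formula C0, v0 φ = v2 (φ.relabel some) :=
    h0.eq_of_le (h2.comp _) (fun φ => hle (.inl φ))
  obtain ⟨C2, w2, hw1, hw2, -, e, he⟩ := exists_saturated T lam hlam v2 h2
  obtain ⟨C1, hC1, hC1c, hb1, hf1⟩ := exists_hull hL hw1 hw2 lam hlam (Set.range e)
    (Cardinal.mk_range_le.trans (by
      rw [Cardinal.mk_option]
      exact Cardinal.add_le_of_le hlam hC0c (Cardinal.one_le_aleph0.trans hlam)))
  let v1 : L.Formula C1 → B := fun φ => w2 (φ.relabel Subtype.val)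
  let e' : Option C0 → C1 := fun o => ⟨e o, hC1 ⟨o, rfl⟩⟩
  have h1 : IsHom v1 := hb1.isHom
  have he' : ∀ φ : L.Formula (Option C0), v1 (φ.relabel e') = v2 φ := by
    intro φ
    rw [← he]
    exact hw1.isHom.relabel_relabel _ _ _
  have hι : ∀ φ : L.Formula C0, v0 φ = v1 (φ.relabel (e' ∘ some)) := by
    intro φ
    rw [heq, ← he', h1.relabel_relabel]
  have hT0 : BModels v0 T := (BModels.of_elem hval (fun φ => rfl)).2 hM.2.2
  have hT1 : BModels v1 T := (BModels.of_elem h1 hι).1 hT0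
  obtain ⟨g, hg1, hg2⟩ := hsat C0 C1 v0 v1 ⟨hb0, hf0, hT0⟩ ⟨hb1, hf1, hT1⟩ hC1c (e' ∘ some) hι
    Subtype.val (fun φ => rfl)
  refine ⟨π (g (e' none)), fun φ hφ => ?_⟩
  let i := em ⟨φ, hφ⟩
  have hi : (enum i).1 = φ := by rw [henum]
  have key : A' {i} ≤ val ((χ i).relabel (Sum.elim (fun _ => g (e' none)) (ρ ∘ a i))) := by
    refine (hle (.inr i)).trans (le_of_eq ?_)
    simp only [Sum.elim_inr, kχ]
    rw [← he', hg1, hval.relabel_relabel, hval.relabel_relabel]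
    congr 2
    funext y
    rcases y with y | y
    · rfl
    · exact congrFun hg2 (b i y)
  have hmem := hU.1.2.2.1 _ _ (hA'3 {i}) key
  rw [hπ.2, Formula.realize_relabel] at hmem
  rw [← hi]
  refine (hχ' i N Subtype.val _).1 ?_
  convert hmem using 1
  funext y
  rcases y with y | y
  · rfl
  · exact (hρ _).symm

end BVal

theorem stmt7_saturation_via_los_maps (B : Type) [CompleteBooleanAlgebra B]
    (U : Set B) (hU : IsBUltrafilter U)
    (L : FirstOrder.Language.{0, 0}) (hL : L.card ≤ ℵ₀)
    (T : L.Theory) (hT : T.IsComplete) (lam : Cardinal) (hlam : ℵ₀ ≤ lam) :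
    List.TFAE
      [Saturates U T lam,
        ∀ A : Finset (Quotient.out lam) → B, IsDistribution A → InFilter A U →
          IsLosMap T A → HasMultRefinement A U,
        ∀ A : Finset (Quotient.out lam) → B, IsDistribution A → InFilter A U →
          IsLosMapOfArity T A 1 → HasMultRefinement A U] := by
  tfae_have 1 → 2 := fun h A _ hA hl => sat_imp_los hU hlam h A hA hl
  tfae_have 2 → 3 := fun h A hd hA ⟨Φ, _, hl⟩ => h A hd hA ⟨Φ, hl⟩
  tfae_have 3 → 1 := los_imp_sat hU hL hlam
  tfae_finish
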